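/- A closed subset S of ℝ³ is spindle-convex if and only if S = ℝ³ or S is the intersection of a nonempty family of closed unit balls. -/

import Mathlib

open scoped InnerProductSpace
open Metric

noncomputable section

abbrev E3 : Type := EuclideanSpace ℝ (Fin 3)

/-- `S` is spindle-convex: for any two distinct points `a b ∈ S` and any circle of
radius `r ≥ 1` (center `c`, lying in the plane through `c` with normal `n`) passing
through `a` and `b`, every point of the (closed) short circular arc with endpoints
`a, b` belongs to `S`.  The short arc is cut off by a hyperplane through the chord
`[a,b]` with in-plane direction `u` pointing towards the short side (`0 ≤ ⟪a-c,u⟫`). -/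
def SpindleConvex (S : Set E3) : Prop :=
  ∀ a ∈ S, ∀ b ∈ S, a ≠ b →
    ∀ (c n u : E3) (r : ℝ), 1 ≤ r →
      ‖a - c‖ = r → ‖b - c‖ = r →
      n ≠ 0 → ⟪a - c, n⟫_ℝ = 0 → ⟪b - c, n⟫_ℝ = 0 →
      u ≠ 0 → ⟪u, n⟫_ℝ = 0 → ⟪a - c, u⟫_ℝ = ⟪b - c, u⟫_ℝ → 0 ≤ ⟪a - c, u⟫_ℝ →
      ∀ p : E3, ‖p - c‖ = r → ⟪p - c, n⟫_ℝ = 0 → ⟪a - c, u⟫_ℝ ≤ ⟪p - c, u⟫_ℝ → p ∈ S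

lemma exists_ne_zero_orthogonal (x y : E3) : ∃ n : E3, n ≠ 0 ∧ ⟪x, n⟫_ℝ = 0 ∧ ⟪y, n⟫_ℝ = 0 := by
  have hlt : Module.finrank ℝ (Submodule.span ℝ ({x, y} : Set E3)) < Module.finrank ℝ E3 := by
    have h := (finrank_span_finset_le_card (R := ℝ) ({x, y} : Finset E3)).trans
      Finset.card_le_two
    have h3 : Module.finrank ℝ E3 = 3 := by simp [E3]
    rw [Finset.coe_pair, Set.finrank] at h
    omega
  have hne : (Submodule.span ℝ ({x, y} : Set E3))ᗮ ≠ ⊥ := by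
    intro h
    rw [Submodule.orthogonal_eq_bot_iff] at h
    rw [h, finrank_top] at hlt
    exact lt_irrefl _ hlt
  obtain ⟨n, hn, hn0⟩ := Submodule.exists_mem_ne_zero_of_ne_bot hne
  rw [Submodule.mem_orthogonal] at hn
  exact ⟨n, hn0, hn x (Submodule.subset_span (by simp)), hn y (Submodule.subset_span (by simp))⟩

lemma eq_zero_of_inner_orthogonal_triple {u v n z : E3} (hu : u ≠ 0) (hv : v ≠ 0) (hn : n ≠ 0)
    (huv : ⟪u, v⟫_ℝ = 0) (hun : ⟪u, n⟫_ℝ = 0) (hvn : ⟪v, n⟫_ℝ = 0)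
    (zu : ⟪z, u⟫_ℝ = 0) (zv : ⟪z, v⟫_ℝ = 0) (zn : ⟪z, n⟫_ℝ = 0) : z = 0 := by
  by_contra hz
  have hli : LinearIndependent ℝ ![z, u, v, n] := by
    apply linearIndependent_of_ne_zero_of_inner_eq_zero
    · intro i; fin_cases i <;> simpa
    · intro i j hij
      fin_cases i <;> fin_cases j <;>
        simp_all [real_inner_comm]
  have h := hli.fintype_card_le_finrank
  simp [E3] at h

lemma norm_sq_smul_add_smul {e m : E3} (h : ⟪e, m⟫_ℝ = 0) (α β : ℝ) :
    ‖α • e + β • m‖ ^ 2 = α ^ 2 * ‖e‖ ^ 2 + β ^ 2 * ‖m‖ ^ 2 := by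
  rw [norm_add_sq_real, inner_smul_left, inner_smul_right, h, norm_smul, norm_smul, mul_pow,
    mul_pow, Real.norm_eq_abs, Real.norm_eq_abs, sq_abs, sq_abs]
  simp

lemma spindleConvex_closedBall (q : E3) : SpindleConvex (closedBall q 1) := by
  intro a ha b hb hab c n u r hr hac hbc hn han hbn hu hun hau hau0 p hpc hpn hpu
  have hdist : ∀ x : E3, ‖x - c‖ = r →
      ‖x - q‖ ^ 2 = r ^ 2 + 2 * ⟪x - c, c - q⟫_ℝ + ‖c - q‖ ^ 2 := by
    intro x hx
    rw [← hx, ← norm_add_sq_real]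
    congr 2
    abel
  have hball : ∀ x : E3, x ∈ closedBall q 1 ↔ ‖x - q‖ ^ 2 ≤ 1 := by
    intro x
    rw [mem_closedBall, dist_eq_norm]
    constructor
    · intro h; nlinarith [norm_nonneg (x - q)]
    · intro h; nlinarith [norm_nonneg (x - q)]
  rw [hball, hdist _ hac] at ha
  rw [hball, hdist _ hbc] at hb
  rw [hball, hdist _ hpc]
  obtain ⟨x, hx⟩ : ∃ x, x = a - c := ⟨_, rfl⟩
  obtain ⟨y, hy⟩ : ∃ y, y = b - c := ⟨_, rfl⟩
  obtain ⟨z, hz⟩ : ∃ z, z = p - c := ⟨_, rfl⟩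
  obtain ⟨w, hw⟩ : ∃ w, w = c - q := ⟨_, rfl⟩
  have hxy : y - x ≠ 0 := by
    rw [hx, hy]
    simpa [sub_eq_zero] using hab.symm
  rw [← hx] at hac han hau hau0 hpu ha
  rw [← hy] at hbc hbn hau hb
  rw [← hz] at hpc hpn hpu ⊢
  rw [← hw] at ha hb ⊢
  clear hdist hball hx hy hz hw
  have hvn : ⟪y - x, n⟫_ℝ = 0 := by rw [inner_sub_left, han, hbn, sub_zero]
  have huv : ⟪u, y - x⟫_ℝ = 0 := by
    rw [inner_sub_right, real_inner_comm, ← hau, real_inner_comm, sub_self]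
  have hxx : ⟪x, x⟫_ℝ = r ^ 2 := by rw [real_inner_self_eq_norm_sq, hac]
  have hyy : ⟪y, y⟫_ℝ = r ^ 2 := by rw [real_inner_self_eq_norm_sq, hbc]
  have hzz : ⟪z, z⟫_ℝ = r ^ 2 := by rw [real_inner_self_eq_norm_sq, hpc]
  have hcomm : ⟪y, x⟫_ℝ = ⟪x, y⟫_ℝ := real_inner_comm _ _
  rcases hau0.eq_or_lt with h0 | hpos
  · have hsum : x + y = 0 := by
      apply eq_zero_of_inner_orthogonal_triple hu hxy hn huv hun hvn
      · rw [inner_add_left, ← hau, ← h0, add_zero]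
      · simp only [inner_add_left, inner_sub_right]
        linarith
      · rw [inner_add_left, han, hbn, add_zero]
    have hyw : ⟪y, w⟫_ℝ = -⟪x, w⟫_ℝ := by
      rw [← inner_neg_left, ← eq_neg_of_add_eq_zero_right hsum]
    have hw0 : w = 0 := by
      rw [← norm_eq_zero]
      nlinarith [norm_nonneg w]
    rw [hw0] at ha ⊢
    simpa using ha
  · set H := ⟪x, u⟫_ℝ with hH
    set k := ⟪y - x, y - x⟫_ℝ with hk
    have hkpos : 0 < k := by
      rw [hk]
      exact real_inner_self_pos.2 hxy
    have hkeq : k = 2 * r ^ 2 - 2 * ⟪x, y⟫_ℝ := by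
      rw [hk]
      simp only [inner_sub_left, inner_sub_right]
      linarith
    set lam := ⟪z, u⟫_ℝ / H with hlam
    set mu := ⟪z, y - x⟫_ℝ / k with hmu
    have hlam1 : 1 ≤ lam := by rwa [hlam, one_le_div hpos]
    have hzeq : z = (lam / 2) • (x + y) + mu • (y - x) := by
      rw [← sub_eq_zero]
      apply eq_zero_of_inner_orthogonal_triple hu hxy hn huv hun hvn
      · have h1 : ⟪y - x, u⟫_ℝ = 0 := by rw [real_inner_comm]; exact huv
        rw [inner_sub_left, inner_add_left, inner_smul_left, inner_smul_left, h1, inner_add_left,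
          ← hau, ← hH, hlam]
        simp only [conj_trivial]
        field_simp
        ring
      · have h1 : ⟪x + y, y - x⟫_ℝ = 0 := by
          simp only [inner_add_left, inner_sub_right]
          linarith
        rw [inner_sub_left, inner_add_left, inner_smul_left, inner_smul_left, h1, ← hk, hmu]
        simp only [conj_trivial]
        field_simp
        ring
      · simp [inner_sub_left, inner_add_left, inner_smul_left, han, hbn, hpn]
    have hnorm : r ^ 2 = lam ^ 2 * (r ^ 2 - k / 4) + mu ^ 2 * k := by
      refine hzz.symm.trans ?_
      rw [hzeq]
      simp only [inner_add_left, inner_sub_right, inner_add_right, inner_sub_left, inner_smul_left,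
        inner_smul_right, conj_trivial, hxx, hyy, hcomm]
      rw [hkeq]
      ring
    have hrk : 0 ≤ r ^ 2 - k / 4 := by
      have := real_inner_self_nonneg (x := x + y)
      simp only [inner_add_left, inner_add_right] at this
      linarith
    have hmu2 : mu ^ 2 ≤ (1 / 2) ^ 2 := by
      have h1 : 1 ≤ lam ^ 2 := by nlinarith
      nlinarith [mul_le_mul_of_nonneg_right h1 hrk]
    have hmuabs := abs_le_of_sq_le_sq' hmu2 (by norm_num)
    have hzw : ⟪z, w⟫_ℝ = (lam / 2 - mu) * ⟪x, w⟫_ℝ + (lam / 2 + mu) * ⟪y, w⟫_ℝ := by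
      rw [hzeq]
      simp only [inner_add_left, inner_sub_left, inner_smul_left, conj_trivial]
      ring
    have hα : 0 ≤ lam / 2 - mu := by linarith
    have hβ : 0 ≤ lam / 2 + mu := by linarith
    obtain ⟨K, hK⟩ : ∃ K, K = (1 - r ^ 2 - ‖w‖ ^ 2) / 2 := ⟨_, rfl⟩
    have hr2 : 1 ≤ r ^ 2 := one_le_pow₀ hr
    have hK0 : K ≤ 0 := by linarith [sq_nonneg ‖w‖]
    have hxK : ⟪x, w⟫_ℝ ≤ K := by linarith
    have hyK : ⟪y, w⟫_ℝ ≤ K := by linarith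
    have h1 := mul_le_mul_of_nonneg_left hxK hα
    have h2 := mul_le_mul_of_nonneg_left hyK hβ
    have h3 : lam * K ≤ K := by
      have := mul_le_mul_of_nonpos_right hlam1 hK0
      linarith
    rw [hzw]
    linarith

lemma SpindleConvex.biInter {ι : Type*} {t : Set ι} {S : ι → Set E3}
    (h : ∀ i ∈ t, SpindleConvex (S i)) : SpindleConvex (⋂ i ∈ t, S i) := by
  intro a ha b hb hab c n u r hr hac hbc hn han hbn hu hun hau hau0 p hpc hpn hpu
  rw [Set.mem_iInter₂] at ha hb ⊢
  exact fun i hi => h i hi a (ha i hi) b (hb i hi) hab c n u r hr hac hbc hn han hbn hu hun hau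
    hau0 p hpc hpn hpu

/-- A rational parametrization of the short arc from `a` to `a + 2 • e` of the circle with
center `a + e - h • m`. -/
lemma SpindleConvex.arc_mem {S : Set E3} (hS : SpindleConvex S) {a e m : E3} {h σ : ℝ}
    (ha : a ∈ S) (hb : a + (2 : ℝ) • e ∈ S) (he : e ≠ 0) (hm : ‖m‖ = 1) (hem : ⟪e, m⟫_ℝ = 0)
    (hh : 0 ≤ h) (hr : 1 ≤ h ^ 2 + ‖e‖ ^ 2) (hσ : 0 ≤ σ) (hσh : σ * h ≤ 1) :
    a + (2 / (1 + ‖e‖ ^ 2 * σ ^ 2)) •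
      ((‖e‖ ^ 2 * σ ^ 2 + σ * h) • e + (‖e‖ ^ 2 * (σ - σ ^ 2 * h)) • m) ∈ S := by
  obtain ⟨n, hn, hen, hmn⟩ := exists_ne_zero_orthogonal e m
  have hm0 : m ≠ 0 := by
    rintro rfl
    simp at hm
  set D := 1 + ‖e‖ ^ 2 * σ ^ 2 with hD
  have hDpos : 0 < D := by positivity
  set α := -1 + 2 / D * (‖e‖ ^ 2 * σ ^ 2 + σ * h) with hα
  set β := h + 2 / D * (‖e‖ ^ 2 * (σ - σ ^ 2 * h)) with hβ
  have hac : a - (a + e - h • m) = (-1 : ℝ) • e + h • m := by module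
  have hbc : a + (2 : ℝ) • e - (a + e - h • m) = (1 : ℝ) • e + h • m := by module
  have hpc : a + (2 / D) • ((‖e‖ ^ 2 * σ ^ 2 + σ * h) • e + (‖e‖ ^ 2 * (σ - σ ^ 2 * h)) • m)
      - (a + e - h • m) = α • e + β • m := by
    rw [hα, hβ]
    module
  have hcoord : ∀ x y : ℝ, ⟪x • e + y • m, m⟫_ℝ = y := by
    intro x y
    simp [inner_add_left, inner_smul_left, hem, hm]
  have hperp : ∀ x y : ℝ, ⟪x • e + y • m, n⟫_ℝ = 0 := by
    intro x y
    simp [inner_add_left, inner_smul_left, hen, hmn]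
  have hnorm : ∀ x y : ℝ, x ^ 2 * ‖e‖ ^ 2 + y ^ 2 = h ^ 2 + ‖e‖ ^ 2 →
      ‖x • e + y • m‖ = √(h ^ 2 + ‖e‖ ^ 2) := by
    intro x y hxy
    rw [← hxy, ← Real.sqrt_sq (norm_nonneg (x • e + y • m)), norm_sq_smul_add_smul hem, hm]
    norm_num
  apply hS a ha _ hb _ (a + e - h • m) n m (√(h ^ 2 + ‖e‖ ^ 2)) (Real.one_le_sqrt.2 hr)
  · rw [hac]; exact hnorm _ _ (by ring)
  · rw [hbc]; exact hnorm _ _ (by ring)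
  · exact hn
  · rw [hac, hperp]
  · rw [hbc, hperp]
  · exact hm0
  · exact hmn
  · rw [hac, hbc, hcoord, hcoord]
  · rw [hac, hcoord]; exact hh
  · rw [hpc]
    apply hnorm
    rw [hα, hβ]
    have : D ≠ 0 := hDpos.ne'
    field_simp
    rw [hD]
    ring
  · rw [hpc, hperp]
  · rw [hac, hpc, hcoord, hcoord, hβ]
    have : 0 ≤ σ - σ ^ 2 * h := by nlinarith
    have : 0 ≤ 2 / D * (‖e‖ ^ 2 * (σ - σ ^ 2 * h)) := by positivity
    linarith
  · simpa using he

lemma SpindleConvex.inner_tangent_nonpos {S : Set E3} (hS : SpindleConvex S) {q e m ν : E3}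
    {h : ℝ} (hq : q ∈ S) (hmin : ∀ z ∈ S, 2 * ⟪z - q, ν⟫_ℝ ≤ ‖z - q‖ ^ 2)
    (hb : q + (2 : ℝ) • e ∈ S) (he : e ≠ 0) (hem : ⟪e, m⟫_ℝ = 0) (hh : 0 ≤ h)
    (hr : 1 ≤ h ^ 2 + ‖e‖ ^ 2) :
    h * ⟪e, ν⟫_ℝ * ‖m‖ + ‖e‖ ^ 2 * ⟪m, ν⟫_ℝ ≤ 0 := by
  wlog hm : ‖m‖ = 1 generalizing m
  · rcases eq_or_ne m 0 with rfl | hm0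
    · simp
    · have hpos : 0 < ‖m‖ := norm_pos_iff.2 hm0
      have h1 : ‖(‖m‖⁻¹) • m‖ = 1 := by
        rw [norm_smul, norm_inv, norm_norm, inv_mul_cancel₀ hpos.ne']
      have key := this (m := (‖m‖⁻¹) • m) (by rw [inner_smul_right, hem, mul_zero]) h1
      rw [h1, inner_smul_left, conj_trivial] at key
      have := mul_nonpos_of_nonneg_of_nonpos hpos.le key
      have heq : ‖m‖ * (h * ⟪e, ν⟫_ℝ * 1 + ‖e‖ ^ 2 * (‖m‖⁻¹ * ⟪m, ν⟫_ℝ)) =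
          h * ⟪e, ν⟫_ℝ * ‖m‖ + ‖e‖ ^ 2 * ⟪m, ν⟫_ℝ := by
        field_simp
      rwa [heq] at this
  rw [hm, mul_one]
  set g := h * ⟪e, ν⟫_ℝ + ‖e‖ ^ 2 * ⟪m, ν⟫_ℝ with hg
  set C := ‖e‖ ^ 2 * (h ^ 2 + ‖e‖ ^ 2 - (⟪e, ν⟫_ℝ - h * ⟪m, ν⟫_ℝ)) with hC
  have key : ∀ σ : ℝ, 0 < σ → σ * h ≤ 1 → g ≤ σ * C := by
    intro σ hσ hσh
    have hz := hmin _ (hS.arc_mem hq hb he hm hem hh hr hσ.le hσh)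
    rw [add_sub_cancel_left, norm_smul, mul_pow, norm_sq_smul_add_smul hem, hm, inner_smul_left,
      inner_add_left, inner_smul_left, inner_smul_left, Real.norm_eq_abs, sq_abs] at hz
    simp only [conj_trivial] at hz
    have hDpos : 0 < 1 + ‖e‖ ^ 2 * σ ^ 2 := by positivity
    have hz2 : 4 * σ / (1 + ‖e‖ ^ 2 * σ ^ 2) * g ≤ 4 * σ / (1 + ‖e‖ ^ 2 * σ ^ 2) * (σ * C) := by
      rw [← sub_nonneg] at hz ⊢
      convert hz using 1
      rw [hg, hC]
      field_simp
      ring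
    exact le_of_mul_le_mul_left hz2 (by positivity)
  by_contra! hgpos
  have hCpos : 0 < 1 + |C| := by positivity
  have hden : 0 < 1 + h + 2 * (1 + |C|) / g := by positivity
  have hσ := key (1 + h + 2 * (1 + |C|) / g)⁻¹ (by positivity) (by
    rw [inv_mul_le_iff₀ hden]
    have : 0 ≤ 2 * (1 + |C|) / g := by positivity
    linarith)
  rw [le_inv_mul_iff₀ hden] at hσ
  have h2 : (1 + h + 2 * (1 + |C|) / g) * g = (1 + h) * g + 2 * (1 + |C|) := by
    field_simp
  have h3 : 0 ≤ (1 + h) * g := by positivity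
  linarith [le_abs_self C]

/-- A unit ball touching a spindle-convex set at a nearest point contains the set. -/
lemma SpindleConvex.subset_closedBall {S : Set E3} (hS : SpindleConvex S) {q ν : E3} {d : ℝ}
    (hν : ‖ν‖ = 1) (hd : 0 < d) (hq : q ∈ S)
    (hmin : ∀ z ∈ S, d ≤ ‖z - (q + d • ν)‖) : S ⊆ closedBall (q - ν) 1 := by
  have hmin' : ∀ z ∈ S, 2 * ⟪z - q, d • ν⟫_ℝ ≤ ‖z - q‖ ^ 2 := by
    intro z hz
    have h1 := hmin z hz
    have h2 : z - (q + d • ν) = (z - q) - d • ν := by abel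
    have h3 : ‖d • ν‖ = d := by rw [norm_smul, hν, Real.norm_of_nonneg hd.le, mul_one]
    have h4 := norm_sub_sq_real (z - q) (d • ν)
    rw [h3] at h4
    rw [h2] at h1
    nlinarith
  have tangent : ∀ e m : E3, ∀ h : ℝ, q + (2 : ℝ) • e ∈ S → e ≠ 0 → ⟪e, m⟫_ℝ = 0 → 0 ≤ h →
      1 ≤ h ^ 2 + ‖e‖ ^ 2 → h * ⟪e, ν⟫_ℝ * ‖m‖ + ‖e‖ ^ 2 * ⟪m, ν⟫_ℝ ≤ 0 := by
    intro e m h hb he hem hh hr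
    have := hS.inner_tangent_nonpos hq hmin' hb he hem hh hr
    rw [inner_smul_right, inner_smul_right] at this
    refine nonpos_of_mul_nonpos_right (a := d) ?_ hd
    linarith
  have hle : ∀ e : E3, q + (2 : ℝ) • e ∈ S → e ≠ 0 → ⟪e, ν⟫_ℝ ≤ 0 := by
    intro e hb he
    obtain ⟨m, hm, hem, -⟩ := exists_ne_zero_orthogonal e e
    by_contra! hpos
    have hmpos : 0 < ‖m‖ := norm_pos_iff.2 hm
    set K := ‖e‖ ^ 2 * ⟪m, ν⟫_ℝ
    have hk := tangent e m (1 + |K| / (⟪e, ν⟫_ℝ * ‖m‖)) hb he hem (by positivity) (by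
      have : 0 ≤ |K| / (⟪e, ν⟫_ℝ * ‖m‖) := by positivity
      nlinarith [sq_nonneg ‖e‖])
    have h2 : (1 + |K| / (⟪e, ν⟫_ℝ * ‖m‖)) * ⟪e, ν⟫_ℝ * ‖m‖ = ⟪e, ν⟫_ℝ * ‖m‖ + |K| := by
      field_simp
    have h3 : 0 < ⟪e, ν⟫_ℝ * ‖m‖ := by positivity
    rw [h2] at hk
    linarith [neg_abs_le K]
  have hcomp : ∀ e : E3, ⟪e, ‖e‖ ^ 2 • ν - ⟪e, ν⟫_ℝ • e⟫_ℝ = 0 ∧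
      ⟪‖e‖ ^ 2 • ν - ⟪e, ν⟫_ℝ • e, ν⟫_ℝ = ‖e‖ ^ 2 - ⟪e, ν⟫_ℝ ^ 2 ∧
      ‖‖e‖ ^ 2 • ν - ⟪e, ν⟫_ℝ • e‖ ^ 2 = ‖e‖ ^ 2 * (‖e‖ ^ 2 - ⟪e, ν⟫_ℝ ^ 2) := by
    intro e
    have hνe : ⟪ν, e⟫_ℝ = ⟪e, ν⟫_ℝ := real_inner_comm _ _
    have hνν : ⟪ν, ν⟫_ℝ = 1 := by rw [real_inner_self_eq_norm_sq, hν]; norm_num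
    have hee : ⟪e, e⟫_ℝ = ‖e‖ ^ 2 := real_inner_self_eq_norm_sq e
    refine ⟨?_, ?_, ?_⟩
    · rw [inner_sub_right, inner_smul_right, inner_smul_right, hee]
      ring
    · rw [inner_sub_left, inner_smul_left, inner_smul_left, hνν]
      simp only [conj_trivial]
      ring
    · rw [← real_inner_self_eq_norm_sq (‖e‖ ^ 2 • ν - ⟪e, ν⟫_ℝ • e)]
      simp only [inner_sub_left, inner_sub_right, inner_smul_left, inner_smul_right, conj_trivial,
        hνe, hνν, hee]
      ring
  have hCS : ∀ e : E3, ⟪e, ν⟫_ℝ ^ 2 ≤ ‖e‖ ^ 2 := by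
    intro e
    have := abs_real_inner_le_norm e ν
    rw [hν, mul_one] at this
    exact sq_le_sq.2 (by rwa [abs_norm])
  have hlong : ∀ e : E3, q + (2 : ℝ) • e ∈ S → 1 < ‖e‖ → ⟪e, ν⟫_ℝ ^ 2 = ‖e‖ ^ 2 := by
    intro e hb h1
    have he : e ≠ 0 := norm_pos_iff.1 (by linarith)
    obtain ⟨c1, c2, -⟩ := hcomp e
    have := tangent e _ 0 hb he c1 le_rfl (by nlinarith)
    rw [c2] at this
    have hpos : 0 < ‖e‖ ^ 2 := by positivity
    have h3 : ‖e‖ ^ 2 - ⟪e, ν⟫_ℝ ^ 2 ≤ 0 :=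
      nonpos_of_mul_nonpos_right (a := ‖e‖ ^ 2) (by linarith) hpos
    linarith [hCS e]
  have hshort : ∀ e : E3, q + (2 : ℝ) • e ∈ S → ‖e‖ ≤ 1 := by
    intro e hb
    by_contra! h1
    have he : e ≠ 0 := norm_pos_iff.1 (by linarith)
    have hE := hlong e hb h1
    obtain ⟨m', hm', hem', -⟩ := exists_ne_zero_orthogonal e e
    obtain ⟨m, hm, hem⟩ : ∃ m : E3, ‖m‖ = 1 ∧ ⟪e, m⟫_ℝ = 0 :=
      ⟨‖m'‖⁻¹ • m', norm_smul_inv_norm hm', by rw [inner_smul_right, hem', mul_zero]⟩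
    have hmν : ⟪m, ν⟫_ℝ = 0 := by
      have h2 := (hcomp e).2.2
      rw [hE, sub_self, mul_zero] at h2
      have h3 : ‖e‖ ^ 2 • ν - ⟪e, ν⟫_ℝ • e = 0 := by simpa using h2
      have h4 : ⟪m, ‖e‖ ^ 2 • ν - ⟪e, ν⟫_ℝ • e⟫_ℝ = 0 := by rw [h3, inner_zero_right]
      rw [inner_sub_right, inner_smul_right, inner_smul_right, real_inner_comm e m, hem,
        mul_zero, sub_zero] at h4
      exact (mul_eq_zero.1 h4).resolve_left (by positivity)
    set L := ‖e‖ ^ 2 with hL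
    have hL1 : 1 < L := by nlinarith
    set σ := 1 / (L - 1) with hσ
    have hσpos : 0 < σ := one_div_pos.2 (by linarith)
    have hσL : σ * (L - 1) = 1 := by
      rw [hσ]
      exact one_div_mul_cancel (by linarith)
    have harc := hS.arc_mem hq hb he hm hem le_rfl (by nlinarith) hσpos.le (by simp)
    rw [← hL] at harc
    set D := 1 + L * σ ^ 2 with hD
    have hDpos : 0 < D := by positivity
    have heq : (2 / D) • ((L * σ ^ 2 + σ * 0) • e + (L * (σ - σ ^ 2 * 0)) • m) =
        (2 : ℝ) • ((L * σ ^ 2 / D) • e + (L * σ / D) • m) := by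
      module
    rw [heq] at harc
    set e' := (L * σ ^ 2 / D) • e + (L * σ / D) • m with he'
    have hn : ‖e'‖ ^ 2 = L ^ 2 * σ ^ 2 / D := by
      rw [he', norm_sq_smul_add_smul hem, hm, ← hL]
      field_simp
      rw [hD]
      ring
    have hi : ⟪e', ν⟫_ℝ = L * σ ^ 2 / D * ⟪e, ν⟫_ℝ := by
      rw [he', inner_add_left, inner_smul_left, inner_smul_left, hmν]
      simp
    have hgt : 1 < ‖e'‖ := by
      have h2 : 1 < ‖e'‖ ^ 2 := by
        rw [hn, one_lt_div hDpos, hD]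
        nlinarith
      nlinarith [norm_nonneg e']
    have hE' := hlong e' harc hgt
    rw [hi, hn, mul_pow, hE] at hE'
    field_simp at hE'
    rw [hD] at hE'
    nlinarith
  intro x hx
  obtain ⟨e, rfl⟩ : ∃ e : E3, x = q + (2 : ℝ) • e := ⟨(2 : ℝ)⁻¹ • (x - q), by module⟩
  have hgoal : ‖e‖ ^ 2 + ⟪e, ν⟫_ℝ ≤ 0 := by
    rcases eq_or_ne e 0 with rfl | he
    · simp
    have hl := hshort e hx
    have hE0 := hle e hx he
    have hlpos : 0 < ‖e‖ := norm_pos_iff.2 he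
    obtain ⟨c1, c2, c3⟩ := hcomp e
    have hsq : 0 ≤ 1 - ‖e‖ ^ 2 := by nlinarith
    have ht := tangent e _ (√(1 - ‖e‖ ^ 2)) hx he c1 (Real.sqrt_nonneg _) (by
      rw [Real.sq_sqrt hsq]; linarith)
    rw [c2] at ht
    have hh := Real.sq_sqrt hsq
    have hh0 := Real.sqrt_nonneg (1 - ‖e‖ ^ 2)
    set h := √(1 - ‖e‖ ^ 2)
    set M := ‖‖e‖ ^ 2 • ν - ⟪e, ν⟫_ℝ • e‖
    set E := ⟪e, ν⟫_ℝ
    rcases (sub_nonneg.2 (hCS e)).eq_or_lt with hD0 | hDpos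
    · nlinarith
    · have h1 : ‖e‖ ^ 2 * (‖e‖ ^ 2 - E ^ 2) ≤ h * (-E) * M := by linarith
      have h2 := pow_le_pow_left₀ (by positivity) h1 2
      have h3 : (h * (-E) * M) ^ 2 = (‖e‖ ^ 2 * (‖e‖ ^ 2 - E ^ 2)) * ((1 - ‖e‖ ^ 2) * E ^ 2) := by
        rw [mul_pow, mul_pow, c3, hh]
        ring
      rw [h3, pow_two] at h2
      have h4 := le_of_mul_le_mul_left h2 (by positivity)
      have h5 : (‖e‖ ^ 2) ^ 2 ≤ (-E) ^ 2 := by nlinarith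
      have := abs_le_of_sq_le_sq h5 (by linarith)
      rw [abs_of_nonneg (by positivity)] at this
      linarith
  rw [mem_closedBall, dist_eq_norm]
  have h1 : q + (2 : ℝ) • e - (q - ν) = (2 : ℝ) • e + ν := by abel
  have h2 : ‖(2 : ℝ) • e + ν‖ ^ 2 = 4 * (‖e‖ ^ 2 + ⟪e, ν⟫_ℝ) + 1 := by
    rw [norm_add_sq_real, norm_smul, inner_smul_left, hν]
    simp only [conj_trivial, Real.norm_ofNat]
    ring
  rw [h1]
  nlinarith [norm_nonneg ((2 : ℝ) • e + ν)]

lemma SpindleConvex.exists_closedBall_of_notMem {S : Set E3} (hcl : IsClosed S)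
    (hS : SpindleConvex S) {p : E3} (hp : p ∉ S) :
    ∃ c, S ⊆ closedBall c 1 ∧ p ∉ closedBall c 1 := by
  rcases S.eq_empty_or_nonempty with rfl | hne
  · obtain ⟨v, hv⟩ := exists_norm_eq E3 (zero_le_two (α := ℝ))
    exact ⟨p + v, Set.empty_subset _, by simp [mem_closedBall, dist_eq_norm, hv]⟩
  obtain ⟨q, hq, hqd⟩ := hcl.exists_infDist_eq_dist hne p
  have hpq : p - q ≠ 0 := sub_ne_zero.2 (fun h => hp (h ▸ hq))
  have hd : 0 < ‖p - q‖ := norm_pos_iff.2 hpq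
  have hν : ‖‖p - q‖⁻¹ • (p - q)‖ = 1 := norm_smul_inv_norm hpq
  have hsmul : ‖p - q‖ • ‖p - q‖⁻¹ • (p - q) = p - q := by
    rw [smul_smul, mul_inv_cancel₀ hd.ne', one_smul]
  refine ⟨_, hS.subset_closedBall hν hd hq fun z hz => ?_, ?_⟩
  · rw [hsmul, add_sub_cancel, ← dist_eq_norm, ← dist_eq_norm, ← hqd, dist_comm z]
    exact infDist_le_dist_of_mem hz
  · rw [mem_closedBall, dist_eq_norm, not_le]
    have h1 : p - (q - ‖p - q‖⁻¹ • (p - q)) = (1 + ‖p - q‖⁻¹) • (p - q) := by module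
    rw [h1, norm_smul, Real.norm_of_nonneg (by positivity), add_mul, inv_mul_cancel₀ hd.ne']
    linarith

/-- A closed subset of ℝ³ is spindle-convex iff it is all of ℝ³ or an intersection of a
nonempty family of closed unit balls. -/
theorem spindleConvex_iff_inter_unitBalls (S : Set E3) (hcl : IsClosed S) :
    SpindleConvex S ↔
      S = Set.univ ∨ ∃ 𝒞 : Set E3, 𝒞.Nonempty ∧ S = ⋂ c ∈ 𝒞, Metric.closedBall c 1 := by
  constructor
  · intro hS
    by_cases hu : S = Set.univ
    · exact Or.inl hu
    obtain ⟨p, hp⟩ := (Set.ne_univ_iff_exists_notMem S).1 hu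
    obtain ⟨c, hc, -⟩ := hS.exists_closedBall_of_notMem hcl hp
    refine Or.inr ⟨{c | S ⊆ closedBall c 1}, ⟨c, hc⟩, ?_⟩
    refine Set.Subset.antisymm (Set.subset_iInter₂ fun c hc => hc) fun x hx => ?_
    by_contra hxS
    obtain ⟨c, hc, hxc⟩ := hS.exists_closedBall_of_notMem hcl hxS
    exact hxc (Set.mem_iInter₂.1 hx c hc)
  · rintro (rfl | ⟨𝒞, -, rfl⟩)
    · intro a _ b _ _ c n u r _ _ _ _ _ _ _ _ _ _ p _ _ _
      exact Set.mem_univ p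
    · exact SpindleConvex.biInter fun c _ => spindleConvex_closedBall c
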